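/- In the Chow ring A_{d,n} of T_{d,n}, with δ_i = δ_{{1,…,i}}, if 1 ≤ k < i ≤ j ≤ n and T ⊆ {1,…,i} with |T| = i - k, then δ_T · δ_i^{kd+1} · δ_{i+1}^d ⋯ δ_j^d · δ_N^{d(n-j)-1} = 0. -/

import Mathlib

/-- The initial segment `{1, …, i}` of `N = {1, …, n}`, realized as the subset
`{x : Fin n | x < i}`. -/
def seg (n i : ℕ) : Finset (Fin n) := Finset.univ.filter fun x => (x : ℕ) < i

/-- The defining relations of the Chow ring of `T_{d,n}`, for a family of ring elements. -/
structure IsChowFamily {R : Type*} [CommRing R] (d n : ℕ) (δ : Finset (Fin n) → R) : Prop where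
  mul_eq_zero_of_crossing : ∀ S T : Finset (Fin n), 2 ≤ S.card → 2 ≤ T.card →
    (S ∩ T).Nonempty → S ∩ T ⊂ S → S ∩ T ⊂ T → δ S * δ T = 0
  sum_pow_eq_zero : ∀ a b : Fin n, a ≠ b →
    (∑ S ∈ Finset.univ.filter (fun S : Finset (Fin n) => a ∈ S ∧ b ∈ S), δ S) ^ d = 0

lemma mem_seg {n i : ℕ} {x : Fin n} : x ∈ seg n i ↔ (x : ℕ) < i := by
  simp [seg]

lemma card_seg {n i : ℕ} (hi : i ≤ n) : (seg n i).card = i := by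
  have h := Fin.card_filter_val_lt (n := n) (m := i)
  simpa [seg, hi] using h

lemma seg_succ {n i : ℕ} (hi : i < n) : seg n (i + 1) = insert ⟨i, hi⟩ (seg n i) := by
  ext x
  simp only [mem_seg, Finset.mem_insert, Fin.ext_iff]
  omega

lemma add_pow_mul_of_mul_eq_zero {R : Type*} [CommRing R] {x y m : R} (h : y * m = 0) (d : ℕ) :
    (x + y) ^ d * m = x ^ d * m := by
  induction d with
  | zero => simp
  | succ d ih => linear_combination (x + y) * ih + x ^ d * h

/-- The part of the monomial lying above `δ_i`. -/
def chainTail {R : Type*} [CommRing R] (d n : ℕ) (δ : Finset (Fin n) → R) (i j : ℕ) : R :=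
  (∏ m ∈ Finset.Icc (i + 1) j, δ (seg n m) ^ d) * δ Finset.univ ^ (d * (n - j) - 1)

lemma chainTail_eq_mul {R : Type*} [CommRing R] {d n : ℕ} (δ : Finset (Fin n) → R) {i j : ℕ}
    (hij : i < j) :
    chainTail d n δ i j = δ (seg n (i + 1)) ^ d * chainTail d n δ (i + 1) j := by
  unfold chainTail
  rw [← Finset.insert_Icc_add_one_left_eq_Icc (Nat.succ_le_of_lt hij),
    Finset.prod_insert (by simp), mul_assoc]

namespace IsChowFamily

variable {R : Type*} [CommRing R] {d n : ℕ} {δ : Finset (Fin n) → R}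

/-- If `m` is annihilated by every `δ_U` with `T ∪ {b} ⊆ U`, except possibly `δ_V`, then
`δ_T δ_V ^ d` annihilates `m`. -/
lemma mul_pow_mul_eq_zero (h : IsChowFamily d n δ) {T V : Finset (Fin n)} {b : Fin n} {m : R}
    (hT : T.Nonempty) (hb : b ∉ T) (hV : insert b T ⊆ V)
    (hm : ∀ U, insert b T ⊆ U → U ≠ V → δ U * m = 0) :
    δ T * δ V ^ d * m = 0 := by
  obtain ⟨a, ha⟩ := hT
  have hab : a ≠ b := fun e => hb (e ▸ ha)
  have hmem : V ∈ Finset.univ.filter (fun S : Finset (Fin n) => a ∈ S ∧ b ∈ S) := by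
    simp [hV (Finset.mem_insert_of_mem ha), hV (Finset.mem_insert_self b T)]
  have hpow := h.sum_pow_eq_zero a b hab
  rw [← Finset.add_sum_erase _ _ hmem] at hpow
  have hrest : (∑ S ∈ (Finset.univ.filter
      (fun S : Finset (Fin n) => a ∈ S ∧ b ∈ S)).erase V, δ S) * (δ T * m) = 0 := by
    rw [Finset.sum_mul]
    refine Finset.sum_eq_zero fun U hU => ?_
    simp only [Finset.mem_erase, Finset.mem_filter, Finset.mem_univ, true_and] at hU
    obtain ⟨hUV, haU, hbU⟩ := hU
    by_cases hTU : T ⊆ U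
    · linear_combination δ T * hm U (Finset.insert_subset hbU hTU) hUV
    · obtain ⟨c, hcT, hcU⟩ := Finset.not_subset.1 hTU
      have hcross := h.mul_eq_zero_of_crossing U T
        (Finset.one_lt_card.2 ⟨a, haU, b, hbU, hab⟩)
        (Finset.one_lt_card.2 ⟨a, ha, c, hcT, fun e => hcU (e ▸ haU)⟩)
        ⟨a, Finset.mem_inter.2 ⟨haU, ha⟩⟩
        (Finset.ssubset_iff_subset_ne.2 ⟨Finset.inter_subset_left,
          fun e => hb (Finset.inter_eq_left.1 e hbU)⟩)
        (Finset.ssubset_iff_subset_ne.2 ⟨Finset.inter_subset_right,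
          fun e => hTU (Finset.inter_eq_right.1 e)⟩)
      linear_combination m * hcross
  have hexpand := add_pow_mul_of_mul_eq_zero (x := δ V) hrest d
  rw [hpow] at hexpand
  linear_combination -hexpand

lemma mul_univ_pow_eq_zero (h : IsChowFamily d n δ) {U : Finset (Fin n)} (hU : U.Nonempty)
    (hne : U ≠ Finset.univ) {e : ℕ} (he : d * (n - U.card) ≤ e) :
    δ U * δ Finset.univ ^ e = 0 := by
  obtain ⟨r, hr⟩ : ∃ r, r = n - U.card := ⟨_, rfl⟩
  induction r using Nat.strong_induction_on generalizing U e with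
  | _ r ih =>
    obtain ⟨b, hb⟩ : ∃ b, b ∉ U := by
      simpa [Finset.eq_univ_iff_forall] using hne
    have hlt : U.card < n := by
      simpa using Finset.card_lt_univ_of_notMem hb
    have hcard : n - U.card = (n - U.card - 1) + 1 := by omega
    rw [hcard, mul_add, mul_one] at he
    have key := h.mul_pow_mul_eq_zero (V := Finset.univ) (m := δ Finset.univ ^ (e - d)) hU hb
      (Finset.subset_univ _) fun W hW hWne => by
        have hWcard := Finset.card_le_card hW
        rw [Finset.card_insert_of_notMem hb] at hWcard
        have hle : n - W.card ≤ n - U.card - 1 := by omega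
        refine ih (n - W.card) (by omega)
          ((Finset.insert_nonempty b U).mono hW) hWne ?_ rfl
        exact (Nat.mul_le_mul_left d hle).trans (by omega)
    rwa [mul_assoc, ← pow_add, Nat.add_sub_cancel' (by omega)] at key

/-- Everything strictly above `{1, …, i}` annihilates `δ_i` times the tail of the monomial. -/
lemma mul_seg_mul_chainTail_eq_zero (h : IsChowFamily d n δ) (hd : 1 ≤ d) {i j : ℕ}
    (hi : 2 ≤ i) (hij : i ≤ j) (hj : j ≤ n) {U : Finset (Fin n)} (hU : seg n i ⊂ U) :
    δ U * (δ (seg n i) * chainTail d n δ i j) = 0 := by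
  induction hij using Nat.decreasingInduction generalizing U with
  | self =>
    have hcard := Finset.card_lt_card hU
    have hUn : U.card ≤ n := by simpa using Finset.card_le_univ U
    rw [card_seg hj] at hcard
    have htail : chainTail d n δ j j = δ Finset.univ ^ (d * (n - j) - 1) := by
      simp [chainTail]
    have hpos : 1 ≤ d * (n - j) := Nat.mul_pos hd (by omega)
    rw [htail]
    by_cases hne : U = Finset.univ
    · have key := h.mul_univ_pow_eq_zero (U := seg n j) (e := d * (n - j))
        (Finset.card_pos.1 (by rw [card_seg hj]; omega)) (hne ▸ hU.ne)
        (by rw [card_seg hj])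
      rw [← Nat.sub_add_cancel hpos, pow_succ] at key
      rw [hne]
      linear_combination key
    · have hsub : n - j = (n - j - 1) + 1 := by omega
      have hle : d * (n - U.card) ≤ d * (n - j - 1) := Nat.mul_le_mul_left d (by omega)
      have hmul : d * (n - j) = d * (n - j - 1) + d := by
        conv_lhs => rw [hsub, mul_add, mul_one]
      have key := h.mul_univ_pow_eq_zero (e := d * (n - j) - 1)
        (Finset.card_pos.1 (by omega)) hne (by omega)
      linear_combination δ (seg n j) * key
  | of_succ i hij ih =>
    have hin : i < n := by omega
    have hb : (⟨i, hin⟩ : Fin n) ∉ seg n i := by simp [mem_seg]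
    have hsi : (seg n i).card = i := card_seg hin.le
    have hss : (seg n (i + 1)).card = i + 1 := card_seg hin
    have hnon : (seg n i).Nonempty := Finset.card_pos.1 (by omega)
    rw [chainTail_eq_mul δ hij]
    by_cases hsub : seg n (i + 1) ⊆ U
    · by_cases heq : U = seg n (i + 1)
      · subst heq
        have key := h.mul_pow_mul_eq_zero (V := seg n (i + 1))
          (m := δ (seg n (i + 1)) * chainTail d n δ (i + 1) j) hnon hb (seg_succ hin).ge
          fun W hW hWne => ih (by omega)
            (Finset.ssubset_iff_subset_ne.2 ⟨(seg_succ hin).le.trans hW, hWne.symm⟩)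
        linear_combination key
      · obtain ⟨e, rfl⟩ : ∃ e, d = e + 1 := ⟨d - 1, by omega⟩
        have key := ih (by omega) (Finset.ssubset_iff_subset_ne.2 ⟨hsub, Ne.symm heq⟩)
        linear_combination δ (seg n i) * δ (seg n (i + 1)) ^ e * key
    · have hcard := Finset.card_lt_card hU
      have hbU : (⟨i, hin⟩ : Fin n) ∉ U := fun hbU =>
        hsub (seg_succ hin ▸ Finset.insert_subset hbU hU.subset)
      have hinter : U ∩ seg n (i + 1) = seg n i := by
        rw [seg_succ hin, Finset.inter_insert_of_notMem hbU, Finset.inter_eq_right.2 hU.subset]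
      have hcross := h.mul_eq_zero_of_crossing U (seg n (i + 1)) (by omega) (by omega)
        (hinter ▸ hnon) (hinter ▸ hU)
        (hinter ▸ seg_succ hin ▸ Finset.ssubset_insert hb)
      obtain ⟨e, rfl⟩ : ∃ e, d = e + 1 := ⟨d - 1, by omega⟩
      linear_combination
        δ (seg n i) * δ (seg n (i + 1)) ^ e * chainTail (e + 1) n δ (i + 1) j * hcross

lemma mul_seg_pow_mul_chainTail_eq_zero (h : IsChowFamily d n δ) (hd : 1 ≤ d) {i j k : ℕ}
    {T : Finset (Fin n)} (hk : 1 ≤ k) (hki : k < i) (hij : i ≤ j) (hj : j ≤ n)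
    (hT : T ⊆ seg n i) (hcard : T.card = i - k) {e : ℕ} (he : k * d + 1 ≤ e) :
    δ T * (δ (seg n i) ^ e * chainTail d n δ i j) = 0 := by
  induction k using Nat.strong_induction_on generalizing T e with
  | _ k ih =>
    have hsi : (seg n i).card = i := card_seg (hij.trans hj)
    obtain ⟨b, hbi, hb⟩ := Finset.exists_mem_notMem_of_card_lt_card (s := T) (t := seg n i)
      (by omega)
    have hnon : T.Nonempty := Finset.card_pos.1 (by omega)
    obtain ⟨l, rfl⟩ : ∃ l, k = l + 1 := ⟨k - 1, by omega⟩
    rw [add_mul, one_mul] at he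
    obtain ⟨f, rfl⟩ : ∃ f, e = d + (f + 1) := ⟨e - d - 1, by omega⟩
    have key := h.mul_pow_mul_eq_zero (V := seg n i)
      (m := δ (seg n i) ^ (f + 1) * chainTail d n δ i j) hnon hb
      (Finset.insert_subset hbi hT) fun U hU hne => by
        have hUcard := Finset.card_le_card hU
        rw [Finset.card_insert_of_notMem hb] at hUcard
        by_cases hUi : U ⊆ seg n i
        · have hlt := Finset.card_lt_card (Finset.ssubset_iff_subset_ne.2 ⟨hUi, hne⟩)
          have hle : (i - U.card) * d ≤ l * d := Nat.mul_le_mul_right d (by omega)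
          exact ih (i - U.card) (by omega) (by omega) (by omega) hUi (by omega) (by omega)
        · by_cases hiU : seg n i ⊆ U
          · linear_combination δ (seg n i) ^ f * h.mul_seg_mul_chainTail_eq_zero hd (by omega)
              hij hj (Finset.ssubset_iff_subset_ne.2 ⟨hiU, hne.symm⟩)
          · have hcross := h.mul_eq_zero_of_crossing U (seg n i)
              (by have := hnon.card_pos; omega) (by omega)
              ⟨b, Finset.mem_inter.2 ⟨hU (Finset.mem_insert_self b T), hbi⟩⟩
              (Finset.ssubset_iff_subset_ne.2 ⟨Finset.inter_subset_left,
                fun e => hUi (Finset.inter_eq_left.1 e)⟩)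
              (Finset.ssubset_iff_subset_ne.2 ⟨Finset.inter_subset_right,
                fun e => hiU (Finset.inter_eq_right.1 e)⟩)
            linear_combination δ (seg n i) ^ f * chainTail d n δ i j * hcross
    linear_combination key

end IsChowFamily

/-- In the Chow ring `A_{d,n}` of `T_{d,n}`, with `δ_i = δ_{{1,…,i}}`: if
`1 ≤ k < i ≤ j ≤ n` and `T ⊆ {1,…,i}` with `|T| = i - k`, then
`δ_T · δ_i^{kd+1} · δ_{i+1}^d ⋯ δ_j^d · δ_N^{d(n-j)-1} = 0`. -/
theorem prop1_2 (d n : ℕ) (hd : 1 ≤ d) (hn : 2 ≤ n)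
    {R : Type*} [CommRing R] (δ : Finset (Fin n) → R)
    (hrel1 : ∀ S T : Finset (Fin n), 2 ≤ S.card → 2 ≤ T.card →
      (S ∩ T).Nonempty → S ∩ T ⊂ S → S ∩ T ⊂ T → δ S * δ T = 0)
    (hrel2 : ∀ a b : Fin n, a ≠ b →
      (∑ S ∈ Finset.univ.filter (fun S : Finset (Fin n) => a ∈ S ∧ b ∈ S), δ S) ^ d = 0) :
    ∀ (i j k : ℕ) (T : Finset (Fin n)), 1 ≤ k → k < i → i ≤ j → j ≤ n →
      T ⊆ seg n i → T.card = i - k →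
      δ T * δ (seg n i) ^ (k * d + 1) *
          (∏ m ∈ Finset.Icc (i + 1) j, δ (seg n m) ^ d) *
          δ Finset.univ ^ (d * (n - j) - 1) = 0 := by
  intro i j k T hk hki hij hj hT hcard
  have h : IsChowFamily d n δ := ⟨hrel1, hrel2⟩
  have key := h.mul_seg_pow_mul_chainTail_eq_zero hd hk hki hij hj hT hcard le_rfl
  rw [chainTail] at key
  linear_combination key
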